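/- arXiv:2501.13680 — 3 statements merged into one kernel-verified Lean document; each statement's English description precedes it below -/
import Mathlib

section
/- Let K be a field of characteristic zero and let 𝒫_1, ..., 𝒫_n be polytopes in ℝ_{≥0}^n; for a polytope 𝒫, let V(𝒫) be the K-vector space of polynomials in K[x_1, ..., x_n] whose support is contained in 𝒫. Suppose g° = (g°_1, ..., g°_n) with g°_i ∈ V(𝒫_i) is such that the minimal polynomial f_min of the elimination ideal ⟨x' − g°⟩^(∞) ∩ K[x_1^{(∞)}] has order n, and let 𝒩 be the Newton polytope of f_min. Then there exists a nonempty Zariski open subset U ⊂ V(𝒫_1) × ⋯ × V(𝒫_n) such that for every g* ∈ U, the minimal polynomial of ⟨x' − g*⟩^(∞) ∩ K[x_1^{(∞)}] has order n and its Newton polytope contains a translate of 𝒩 by some vector in ℝ_{≥0}^{n+1}. -/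
open MvPolynomial

noncomputable section

/-- The canonical derivation on the ring of differential polynomials
`K[x_i^{(j)} : 1 ≤ i ≤ n, j ≥ 0]`, sending `x_i^{(j)}` to `x_i^{(j+1)}`. -/
def diffDer (K : Type*) [CommRing K] (n : ℕ) :
    Derivation K (MvPolynomial (Fin n × ℕ) K) (MvPolynomial (Fin n × ℕ) K) :=
  MvPolynomial.mkDerivation K fun v => X (v.1, v.2 + 1)

/-- The differential ideal generated by a set `S`: the ideal generated by all
derivatives of elements of `S`. -/
def diffIdeal (K : Type*) [CommRing K] (n : ℕ) (S : Set (MvPolynomial (Fin n × ℕ) K)) :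
    Ideal (MvPolynomial (Fin n × ℕ) K) :=
  Ideal.span {q | ∃ f ∈ S, ∃ j : ℕ, q = (⇑(diffDer K n))^[j] f}

/-- The differential ideal `I_g = ⟨x_1' - g_1, …, x_n' - g_n⟩^(∞)` of the
system `x' = g(x)`. -/
def sysIdeal (K : Type*) [CommRing K] (n : ℕ) (g : Fin n → MvPolynomial (Fin n) K) :
    Ideal (MvPolynomial (Fin n × ℕ) K) :=
  diffIdeal K n (Set.range fun i => X (i, 1) - rename (fun j => (j, 0)) (g i))

/-- The order of a differential polynomial: the largest `j` such that some variable
`x_i^{(j)}` appears. -/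
def ordOf {K : Type*} [CommSemiring K] {n : ℕ} (f : MvPolynomial (Fin n × ℕ) K) : ℕ :=
  f.vars.sup Prod.snd

/-- `f` is a minimal polynomial of the elimination ideal `I ∩ K[x_1^{(∞)}]`:
a nonzero element of `I` involving only the variables `x_1^{(j)}`, of minimal order and
then minimal total degree among all such elements. -/
def IsMinPoly (K : Type*) [Field K] (n : ℕ) [NeZero n]
    (I : Ideal (MvPolynomial (Fin n × ℕ) K)) (f : MvPolynomial (Fin n × ℕ) K) : Prop :=
  f ≠ 0 ∧ f ∈ I ∧ (∀ v ∈ f.vars, v.1 = (0 : Fin n)) ∧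
    ∀ h : MvPolynomial (Fin n × ℕ) K, h ≠ 0 → h ∈ I → (∀ v ∈ h.vars, v.1 = (0 : Fin n)) →
      ordOf f ≤ ordOf h ∧ (ordOf h ≤ ordOf f → f.totalDegree ≤ h.totalDegree)

/-- The set of exponent vectors `(e_0, …, e_ν)` of the monomials
`x_1^{e_0} (x_1')^{e_1} ⋯ (x_1^{(ν)})^{e_ν}` of a differential polynomial in `x_1`. -/
def expVecs (K : Type*) [CommSemiring K] (n ν : ℕ) [NeZero n]
    (f : MvPolynomial (Fin n × ℕ) K) : Set (Fin (ν + 1) → ℝ) :=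
  {e | ∃ m ∈ f.support, e = fun k : Fin (ν + 1) => (m ((0 : Fin n), (k : ℕ)) : ℝ)}

/-- The Newton polytope of a differential polynomial in `x_1` of order at most `ν`. -/
def newtonPolytope (K : Type*) [CommSemiring K] (n ν : ℕ) [NeZero n]
    (f : MvPolynomial (Fin n × ℕ) K) : Set (Fin (ν + 1) → ℝ) :=
  convexHull ℝ (expVecs K n ν f)

theorem MvPolynomial.aeval_map_map_comp {A B ι τ : Type*} [CommRing A] [CommRing B] (φ : A →+* B)
    (q : ι → MvPolynomial τ A) (h : MvPolynomial ι A) :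
    aeval (fun i => map φ (q i)) (map φ h) = map φ (aeval q h) := by
  induction h using MvPolynomial.induction_on with
  | C a => simp
  | add p q hp hq => simp only [map_add, hp, hq]
  | mul_X p i hp => simp only [map_mul, hp, map_X, aeval_X]

/-- A nonzero algebraic relation over a polynomial ring specializes, after dividing out a power of
a line parameter, to a nonzero relation at every point, with no new monomials. -/
theorem MvPolynomial.exists_specialized_relation {K σ ι τ : Type*} [Field K] [Infinite K]
    (q : ι → MvPolynomial τ (MvPolynomial σ K)) (F : MvPolynomial ι (MvPolynomial σ K))
    (hF : F ≠ 0) (hq : aeval q F = 0) (c : σ → K) :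
    ∃ F₀ : MvPolynomial ι K, F₀ ≠ 0 ∧ F₀.support ⊆ F.support ∧
      aeval (fun i => map (eval c) (q i)) F₀ = 0 := by
  obtain ⟨m, hm⟩ := MvPolynomial.ne_zero_iff.1 hF
  obtain ⟨b, hb⟩ : ∃ b : σ → K, eval b (coeff m F) ≠ 0 := by
    by_contra! H
    exact hm (MvPolynomial.funext fun x => by simpa using H x)
  let ψ : MvPolynomial σ K →+* Polynomial K :=
    (aeval fun s => Polynomial.C (c s) + Polynomial.X * Polynomial.C (b s - c s)).toRingHom
  have hψ0 : (Polynomial.evalRingHom 0).comp ψ = eval c := by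
    ext <;> simp [ψ]
  have hψ1 : (Polynomial.evalRingHom 1).comp ψ = eval b := by
    ext <;> simp [ψ]
  have hne : map ψ F ≠ 0 := by
    intro h
    apply hb
    rw [← hψ1, RingHom.comp_apply, ← coeff_map, h]
    simp
  have hfin : FiniteMultiplicity (C Polynomial.X : MvPolynomial ι (Polynomial K)) (map ψ F) := by
    refine FiniteMultiplicity.of_not_isUnit ?_ hne
    intro hu
    have := hu.map (constantCoeff (σ := ι) (R := Polynomial K))
    simp [Polynomial.not_isUnit_X] at this
  obtain ⟨H, hH, hHX⟩ := hfin.exists_eq_pow_mul_and_not_dvd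
  generalize multiplicity (C Polynomial.X : MvPolynomial ι (Polynomial K)) (map ψ F) = k at hH
  refine ⟨map (Polynomial.evalRingHom 0) H, ?_, ?_, ?_⟩
  · intro h0
    apply hHX
    rw [C_dvd_iff_dvd_coeff]
    intro i
    rw [Polynomial.X_dvd_iff, Polynomial.coeff_zero_eq_eval_zero, ← Polynomial.coe_evalRingHom,
      ← coeff_map, h0, coeff_zero]
  · refine (support_map_subset _ _).trans (subset_trans ?_ (support_map_subset ψ F))
    intro i hi
    rw [mem_support_iff] at hi ⊢
    rw [hH, ← C_pow, coeff_C_mul]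
    exact mul_ne_zero (pow_ne_zero _ Polynomial.X_ne_zero) hi
  · have h1 : aeval (fun i => map ψ (q i)) (map ψ F) = 0 := by
      rw [aeval_map_map_comp, hq, map_zero]
    rw [hH, map_mul, map_pow, mul_eq_zero] at h1
    have h2 : aeval (fun i => map ψ (q i)) H = 0 := by
      refine h1.resolve_left (pow_ne_zero _ ?_)
      rw [aeval_C]
      simp [Polynomial.X_ne_zero]
    have h3 := aeval_map_map_comp (Polynomial.evalRingHom 0) (fun i => map ψ (q i)) H
    rw [h2, map_zero] at h3
    simpa only [map_map, hψ0] using h3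

/-- A matrix over a domain with linearly independent rows has a right inverse up to a nonzero
scalar. -/
theorem Matrix.exists_mul_eq_smul_one {A I T : Type*} [CommRing A] [IsDomain A] [Fintype I]
    [Fintype T] [DecidableEq I] (M : Matrix I T A) (hM : ∀ c : I → A, Matrix.vecMul c M = 0 → c = 0) :
    ∃ (B : Matrix T I A) (P : A), P ≠ 0 ∧ M * B = P • (1 : Matrix I I A) := by
  classical
  let L := FractionRing A
  let M' : Matrix I T L := M.map (algebraMap A L)
  have hinj : Function.Injective M'.vecMulLinear := by
    rw [injective_iff_map_eq_zero]
    intro c hc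
    obtain ⟨b, hb⟩ := IsLocalization.exist_integer_multiples_of_finite (nonZeroDivisors A) c
    choose a ha using hb
    have h0 : a = 0 := by
      apply hM
      ext t
      apply IsFractionRing.injective A L
      have := congrFun hc t
      simp only [Matrix.vecMulLinear_apply, Matrix.vecMul, dotProduct, Pi.zero_apply] at this ⊢
      rw [map_sum, map_zero]
      simp only [map_mul, ha, Algebra.smul_def, mul_assoc, ← Finset.mul_sum]
      simp only [M', Matrix.map_apply] at this
      rw [this, mul_zero]
    ext i
    have := ha i
    rw [h0, Pi.zero_apply, map_zero, Algebra.smul_def, eq_comm, mul_eq_zero] at this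
    exact this.resolve_left (by simp)
  obtain ⟨g, hg⟩ := LinearMap.exists_leftInverse_of_injective M'.vecMulLinear
    (LinearMap.ker_eq_bot.2 hinj)
  let B' : Matrix T I L := fun t i => g (Pi.single t 1) i
  have hB' : M' * B' = 1 := by
    ext i j
    have h1 : g (M' i) = Pi.single i 1 := by
      have := LinearMap.congr_fun hg (Pi.single i 1)
      rw [LinearMap.comp_apply, Matrix.vecMulLinear_apply, Matrix.single_one_vecMul] at this
      exact this
    have h2 : M' i = ∑ t, M' i t • Pi.single t (1 : L) := pi_eq_sum_univ' (M' i)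
    rw [h2, map_sum] at h1
    have := congrFun h1 j
    simp only [Finset.sum_apply, map_smul, Pi.smul_apply, smul_eq_mul] at this
    rw [Matrix.mul_apply, this, Matrix.one_apply, Pi.single_apply]
    simp [eq_comm]
  obtain ⟨b, hb⟩ := IsLocalization.exist_integer_multiples_of_finite (nonZeroDivisors A)
    (fun p : T × I => B' p.1 p.2)
  choose a ha using hb
  refine ⟨Matrix.of fun t i => a (t, i), b, nonZeroDivisors.coe_ne_zero b, ?_⟩
  ext i j
  apply IsFractionRing.injective A L
  have := congrFun (congrFun hB' i) j
  simp only [Matrix.mul_apply, M', Matrix.map_apply] at this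
  simp only [Matrix.mul_apply, Matrix.of_apply, map_sum, map_mul, ha, Algebra.smul_def,
    Matrix.smul_apply,
    mul_left_comm _ (algebraMap A L b), ← Finset.mul_sum, this]
  congr 1
  simp [Matrix.one_apply, apply_ite]

/-- A lower bound for the total degree of relations persists on a nonempty open set of
specializations. -/
theorem MvPolynomial.exists_forall_le_totalDegree_of_map_ne_zero {A B ι τ : Type*} [CommRing A]
    [IsDomain A] [CommRing B] [IsDomain B] [Finite ι] (q : ι → MvPolynomial τ A) (d : ℕ)
    (hd : ∀ h : MvPolynomial ι A, h ≠ 0 → aeval q h = 0 → d ≤ h.totalDegree) :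
    ∃ P : A, P ≠ 0 ∧ ∀ φ : A →+* B, φ P ≠ 0 →
      ∀ h : MvPolynomial ι B, h ≠ 0 → aeval (fun i => map φ (q i)) h = 0 → d ≤ h.totalDegree := by
  classical
  rcases Nat.eq_zero_or_pos d with rfl | hpos
  · exact ⟨1, one_ne_zero, fun _ _ _ _ _ => Nat.zero_le _⟩
  let S : Finset (ι →₀ ℕ) := (Finsupp.finite_of_degree_le (σ := ι) (d - 1)).toFinset
  have hS : ∀ m, m ∈ S ↔ m.degree ≤ d - 1 := fun m => by simp [S]
  let T : Finset (τ →₀ ℕ) := S.biUnion fun m => (aeval q (monomial m (1 : A))).support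
  let M : Matrix S T A := Matrix.of fun m t => coeff t.1 (aeval q (monomial m.1 (1 : A)))
  have hM : ∀ c : S → A, Matrix.vecMul c M = 0 → c = 0 := by
    intro c hc
    let h : MvPolynomial ι A := ∑ m : S, monomial m.1 (c m)
    have hcoeff : ∀ m : S, coeff m.1 h = c m := by
      intro m
      simp [h, coeff_sum, coeff_monomial]
    have hrel : aeval q h = 0 := by
      have he : aeval q h = ∑ m : S, C (c m) * aeval q (monomial m.1 (1 : A)) := by
        rw [map_sum]
        refine Finset.sum_congr rfl fun m _ => ?_
        rw [show monomial m.1 (c m) = C (c m) * monomial m.1 1 by rw [C_mul_monomial, mul_one],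
          map_mul, aeval_C, algebraMap_eq]
      ext t
      rw [he, coeff_sum, coeff_zero]
      simp only [coeff_C_mul]
      by_cases ht : t ∈ T
      · exact congrFun hc ⟨t, ht⟩
      · refine Finset.sum_eq_zero fun m _ => ?_
        have : t ∉ (aeval q (monomial m.1 (1 : A))).support := fun hm =>
          ht (Finset.mem_biUnion.2 ⟨m.1, m.2, hm⟩)
        rw [notMem_support_iff.1 this, mul_zero]
    have h0 : h = 0 := by
      by_contra hne
      have h1 := hd h hne hrel
      have h2 : h.totalDegree ≤ d - 1 := by
        refine (totalDegree_finsetSum _ _).trans (Finset.sup_le fun m _ => ?_)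
        exact (totalDegree_monomial_le _ _).trans ((hS _).1 m.2)
      omega
    ext m
    rw [← hcoeff m, h0, coeff_zero, Pi.zero_apply]
  obtain ⟨N, P, hP, hMN⟩ := Matrix.exists_mul_eq_smul_one M hM
  refine ⟨P, hP, fun φ hφ h hne hrel => ?_⟩
  by_contra hlt
  have hsupp : h.support ⊆ S := by
    intro m hm
    have : m.degree ≤ h.totalDegree := le_totalDegree hm
    rw [hS]
    omega
  let c : S → B := fun m => coeff m.1 h
  have hc : Matrix.vecMul c (M.map φ) = 0 := by
    ext t
    have he : aeval (fun i => map φ (q i)) h =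
        ∑ m : S, C (c m) * map φ (aeval q (monomial m.1 (1 : A))) := by
      conv_lhs => rw [h.as_sum, map_sum]
      rw [Finset.sum_subset hsupp, ← Finset.sum_coe_sort S]
      · refine Finset.sum_congr rfl fun m _ => ?_
        rw [← aeval_map_map_comp, map_monomial, map_one,
          show monomial m.1 (coeff m.1 h) = C (c m) * monomial m.1 1 by rw [C_mul_monomial, mul_one],
          map_mul, aeval_C, algebraMap_eq]
      · intro m _ hm
        rw [notMem_support_iff.1 hm, monomial_zero, map_zero]
    rw [hrel] at he
    have := congrArg (coeff t.1) he
    rw [coeff_zero, coeff_sum] at this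
    simp only [coeff_C_mul, coeff_map] at this
    exact this.symm
  have hc0 : c = 0 := by
    have h1 : M.map φ * N.map φ = φ P • (1 : Matrix S S B) := by
      rw [← Matrix.map_mul, hMN]
      ext i j
      simp [Matrix.one_apply, apply_ite φ]
    have h2 : Matrix.vecMul c (M.map φ * N.map φ) = 0 := by
      rw [← Matrix.vecMul_vecMul, hc, Matrix.zero_vecMul]
    rw [h1, Matrix.vecMul_smul, Matrix.vecMul_one] at h2
    exact (smul_eq_zero.1 h2).resolve_left hφ
  apply hne
  ext m
  by_cases hm : m ∈ S
  · exact congrFun hc0 ⟨m, hm⟩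
  · rw [notMem_support_iff.1 fun h' => hm (hsupp h'), coeff_zero]

/-- Algebraic independence persists on a nonempty open set of specializations. -/
theorem MvPolynomial.exists_forall_algebraicIndependent_of_map_ne_zero {A L ι : Type*} [CommRing A]
    [IsDomain A] [Field L] [Fintype ι] (q : ι → MvPolynomial ι A)
    (hq : AlgebraicIndependent A q) :
    ∃ P : A, P ≠ 0 ∧ ∀ φ : A →+* L, φ P ≠ 0 →
      AlgebraicIndependent L (fun i => map φ (q i)) := by
  classical
  have hbasis : IsTranscendenceBasis A q :=
    hq.isTranscendenceBasis_of_lift_trdeg_le_of_finite (by simp)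
  have halg := hbasis.isAlgebraic
  have hrel : ∀ j : ι, ∃ Q : MvPolynomial (Option ι) A, Q ≠ 0 ∧
      aeval (fun o : Option ι => o.elim (X j) q) Q = 0 := by
    intro j
    have h1 : ¬ AlgebraicIndependent A (fun o : Option ι => o.elim (X j) q) := by
      rw [hq.option_iff_transcendental]
      exact fun h => h (halg.isAlgebraic (X j))
    rw [algebraicIndependent_iff] at h1
    push Not at h1
    obtain ⟨Q, h2, h3⟩ := h1
    exact ⟨Q, h3, h2⟩
  choose Q hQ0 hQ using hrel
  let R : ι → Polynomial (MvPolynomial ι A) := fun j => optionEquivLeft A ι (Q j)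
  have hlead : ∀ j, aeval q (R j).leadingCoeff ≠ 0 := by
    intro j h
    have := hq.eq_zero_of_aeval_eq_zero _ h
    rw [Polynomial.leadingCoeff_eq_zero] at this
    exact hQ0 j ((map_eq_zero_iff _ (optionEquivLeft A ι).injective).1 this)
  choose m hm using fun j => MvPolynomial.ne_zero_iff.1 (hlead j)
  refine ⟨∏ j, coeff (m j) (aeval q (R j).leadingCoeff), Finset.prod_ne_zero_iff.2 fun j _ => hm j,
    fun φ hφ => ?_⟩
  rw [map_prod, Finset.prod_ne_zero_iff] at hφ
  let q' : ι → MvPolynomial ι L := fun i => map φ (q i)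
  let S := Algebra.adjoin L (Set.range q')
  let ρ : MvPolynomial ι A →+* S := RingHom.comp
    (aeval fun i => (⟨q' i, Algebra.subset_adjoin ⟨i, rfl⟩⟩ : S)).toRingHom (map φ)
  have hρ : (algebraMap S (MvPolynomial ι L)).comp ρ = (map φ).comp (aeval q).toRingHom := by
    apply MvPolynomial.ringHom_ext
    · intro a
      simp [ρ]
    · intro i
      simp [ρ, q']
  have hX : ∀ j, IsAlgebraic S (X j : MvPolynomial ι L) := by
    intro j
    refine ⟨(R j).map ρ, fun h0 => ?_, ?_⟩
    · have h1 := congrArg (fun p => algebraMap S (MvPolynomial ι L) (p.coeff (R j).natDegree)) h0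
      simp only [Polynomial.coeff_map, Polynomial.coeff_zero, map_zero] at h1
      have h2 := RingHom.congr_fun hρ (R j).leadingCoeff
      rw [RingHom.comp_apply] at h2
      have h3 := h2.symm.trans h1
      apply hφ j (Finset.mem_univ j)
      rw [← coeff_map]
      exact (congrArg (coeff (m j)) h3).trans (coeff_zero _)
    · rw [Polynomial.aeval_def, Polynomial.eval₂_map, hρ]
      have h1 : (Polynomial.eval₂RingHom ((map φ).comp (aeval q).toRingHom)
          (X j : MvPolynomial ι L)).comp (optionEquivLeft A ι).toAlgHom.toRingHom =
          (map φ).comp (aeval fun o : Option ι => o.elim (X j) q).toRingHom := by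
        apply MvPolynomial.ringHom_ext
        · intro a
          simp [optionEquivLeft_C]
        · rintro (_ | i)
          · simp [optionEquivLeft_X_none]
          · simp [optionEquivLeft_X_some]
      have h2 := RingHom.congr_fun h1 (Q j)
      refine h2.trans ?_
      change map φ (aeval _ (Q j)) = 0
      rw [hQ, map_zero]
  have halg' : Algebra.IsAlgebraic S (MvPolynomial ι L) := by
    constructor
    intro p
    induction p using MvPolynomial.induction_on with
    | C a => exact isAlgebraic_algebraMap (algebraMap L S a)
    | add p r hp hr => exact hp.add hr
    | mul_X p i hp => exact hp.mul (hX i)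
  exact (Algebra.IsAlgebraic.isTranscendenceBasis_of_lift_le_trdeg_of_finite L q'
    (by simp)).1

/-- If all but one of the elements `q` are algebraically independent, a relation of minimal total
degree divides every other relation. -/
theorem MvPolynomial.dvd_of_minimal_relation {K B ι : Type*} [Field K] [CommRing B] [IsDomain B]
    [Algebra K B] (q : Option ι → B) (hq : AlgebraicIndependent K (fun i => q (some i)))
    (f : MvPolynomial (Option ι) K) (hf0 : f ≠ 0) (hf : aeval q f = 0)
    (hmin : ∀ h : MvPolynomial (Option ι) K, h ≠ 0 → aeval q h = 0 →
      f.totalDegree ≤ h.totalDegree)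
    (h : MvPolynomial (Option ι) K) (hh : aeval q h = 0) : f ∣ h := by
  have hirr : Irreducible f := by
    have key : ∀ a b, f = a * b → aeval q a = 0 → IsUnit b := by
      intro a b hab ha
      have ha0 : a ≠ 0 := by rintro rfl; simp [hab] at hf0
      have hb0 : b ≠ 0 := by rintro rfl; simp [hab] at hf0
      have h1 := hmin a ha0 ha
      rw [hab, totalDegree_mul_of_isDomain ha0 hb0] at h1
      have h2 : b.totalDegree = 0 := by omega
      rw [totalDegree_eq_zero_iff_eq_C] at h2
      rw [h2] at hb0 ⊢
      exact (IsUnit.mk0 _ fun h => hb0 (by rw [h, C_0])).map C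
    constructor
    · intro hu
      exact (hu.map (aeval q)).ne_zero hf
    · intro a b hab
      have h1 := hf
      rw [hab, map_mul, mul_eq_zero] at h1
      rcases h1 with h1 | h1
      · exact Or.inr (key a b hab h1)
      · exact Or.inl (key b a (hab.trans (mul_comm _ _)) h1)
  let E := optionEquivLeft K ι
  let _ : GCDMonoid (MvPolynomial ι K) := UniqueFactorizationMonoid.toGCDMonoid _
  let F := FractionRing (MvPolynomial ι K)
  let T := FractionRing B
  let θ : MvPolynomial ι K →+* T :=
    (algebraMap B T).comp (aeval fun i => q (some i)).toRingHom
  have hθ : Function.Injective θ :=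
    (IsFractionRing.injective B T).comp (algebraicIndependent_iff_injective_aeval.1 hq)
  let θ' : F →+* T := IsFractionRing.lift hθ
  have hθ' : θ'.comp (algebraMap _ F) = θ := by
    ext x <;> simp [θ', IsFractionRing.lift_algebraMap]
  have heval : ∀ g, Polynomial.eval₂ θ (algebraMap B T (q none)) (E g) =
      algebraMap B T (aeval q g) := by
    intro g
    have h1 : (Polynomial.eval₂RingHom θ (algebraMap B T (q none))).comp E.toAlgHom.toRingHom =
        (algebraMap B T).comp (aeval q).toRingHom := by
      apply MvPolynomial.ringHom_ext
      · intro a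
        simp [E, θ, optionEquivLeft_C]
      · rintro (_ | i)
        · simp [E, optionEquivLeft_X_none]
        · simp [E, θ, optionEquivLeft_X_some]
    exact RingHom.congr_fun h1 g
  have hEirr : Irreducible (E f) := (MulEquiv.irreducible_iff E.toMulEquiv).2 hirr
  have hdeg : (E f).natDegree ≠ 0 := by
    intro h0
    have h1 := heval f
    have h2 := Polynomial.eq_C_of_natDegree_eq_zero h0
    rw [hf, map_zero, h2, Polynomial.eval₂_C, map_eq_zero_iff θ hθ] at h1
    rw [h1, Polynomial.C_0] at h2
    exact hEirr.ne_zero h2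
  have hprim : (E f).IsPrimitive := hEirr.isPrimitive hdeg
  have hFirr := (hprim.irreducible_iff_irreducible_map_fraction_map (K := F)).1 hEirr
  suffices hdvd : E f ∣ E h by
    have := map_dvd E.symm hdvd
    simpa using this
  rw [hprim.dvd_iff_fraction_map_dvd_fraction_map F]
  by_contra hnd
  obtain ⟨u, v, huv⟩ := hFirr.coprime_iff_not_dvd.2 hnd
  have h1 := congrArg (Polynomial.eval₂ θ' (algebraMap B T (q none))) huv
  simp only [Polynomial.eval₂_add, Polynomial.eval₂_mul, Polynomial.eval₂_map, hθ', heval, hf, hh,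
    map_zero, mul_zero, add_zero, Polynomial.eval₂_one] at h1
  exact zero_ne_one h1

theorem MvPolynomial.exists_mem_support_mul_of_linear {K ι : Type*} [Field K]
    (ℓ : (ι →₀ ℕ) →+ ℝ) (f g : MvPolynomial ι K) {a b : ι →₀ ℕ} (ha : a ∈ f.support)
    (hb : b ∈ g.support) : ∃ m ∈ (f * g).support, ℓ a + ℓ b ≤ ℓ m := by
  classical
  obtain ⟨a₁, ha₁, hamax⟩ := Finset.exists_max_image f.support ℓ ⟨a, ha⟩
  obtain ⟨b₁, hb₁, hbmax⟩ := Finset.exists_max_image g.support ℓ ⟨b, hb⟩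
  obtain ⟨a₀, ha₀, b₀, hb₀, huniq⟩ := UniqueSums.uniqueAdd_of_nonempty
    (A := f.support.filter fun m => ℓ m = ℓ a₁) (B := g.support.filter fun m => ℓ m = ℓ b₁)
    ⟨a₁, by simpa using ha₁⟩ ⟨b₁, by simpa using hb₁⟩
  rw [Finset.mem_filter] at ha₀ hb₀
  refine ⟨a₀ + b₀, ?_, ?_⟩
  · rw [mem_support_iff, coeff_mul, Finset.sum_eq_single (a₀, b₀)]
    · exact mul_ne_zero (mem_support_iff.1 ha₀.1) (mem_support_iff.1 hb₀.1)
    · rintro ⟨x, y⟩ hxy hne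
      by_contra h0
      have hx : x ∈ f.support := mem_support_iff.2 (left_ne_zero_of_mul h0)
      have hy : y ∈ g.support := mem_support_iff.2 (right_ne_zero_of_mul h0)
      have hs : x + y = a₀ + b₀ := Finset.HasAntidiagonal.mem_antidiagonal.1 hxy
      have hℓ := congrArg ℓ hs
      rw [map_add, map_add, ha₀.2, hb₀.2] at hℓ
      have h1 := hamax x hx
      have h2 := hbmax y hy
      obtain ⟨rfl, rfl⟩ := huniq (Finset.mem_filter.2 ⟨hx, by linarith⟩)
        (Finset.mem_filter.2 ⟨hy, by linarith⟩) hs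
      exact hne rfl
    · simp
  · rw [map_add, ha₀.2, hb₀.2]
    exact add_le_add (hamax a ha) (hbmax b hb)

theorem MvPolynomial.add_mem_convexHull_support_mul {K ι E : Type*} [Field K]
    [NormedAddCommGroup E] [NormedSpace ℝ E] (w : (ι →₀ ℕ) →+ E)
    (f g : MvPolynomial ι K) {a b : ι →₀ ℕ} (ha : a ∈ f.support) (hb : b ∈ g.support) :
    w a + w b ∈ convexHull ℝ (w '' ((f * g).support : Set (ι →₀ ℕ))) := by
  by_contra hnot
  have hfin : (w '' ((f * g).support : Set (ι →₀ ℕ))).Finite := (Finset.finite_toSet _).image _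
  obtain ⟨ℓ, u, h1, h2⟩ := geometric_hahn_banach_closed_point (convex_convexHull ℝ _)
    (hfin.isClosed_convexHull ℝ) hnot
  obtain ⟨m, hm, hle⟩ := exists_mem_support_mul_of_linear
    (ℓ.toLinearMap.toAddMonoidHom.comp w) f g ha hb
  have h3 := h1 (w m) (subset_convexHull ℝ _ ⟨m, hm, rfl⟩)
  rw [map_add] at h2
  have h4 : ℓ (w a) + ℓ (w b) ≤ ℓ (w m) := hle
  linarith

theorem MvPolynomial.exists_relation_minimal_totalDegree {A B ι : Type*} [CommRing A] [CommRing B]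
    [Algebra A B] (q : ι → B) (hq : ∃ h : MvPolynomial ι A, h ≠ 0 ∧ aeval q h = 0) :
    ∃ f : MvPolynomial ι A, f ≠ 0 ∧ aeval q f = 0 ∧
      ∀ h : MvPolynomial ι A, h ≠ 0 → aeval q h = 0 → f.totalDegree ≤ h.totalDegree := by
  obtain ⟨f, ⟨hf0, hf⟩, hmin⟩ := (measure (totalDegree (R := A) (σ := ι))).wf.has_min
    {h | h ≠ 0 ∧ aeval q h = 0} hq
  exact ⟨f, hf0, hf, fun h h0 hr => not_lt.1 (hmin h ⟨h0, hr⟩)⟩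

/-- The specialization of a generic family near a given point: on a nonempty open set, independence
persists and the Newton polytope of a minimal relation contains a translate of the one at the given
point. -/
theorem MvPolynomial.exists_generic_minimal_relation {K σ ι E : Type*} [Field K] [Infinite K]
    [Fintype ι] [NormedAddCommGroup E] [NormedSpace ℝ E] (w : (Option ι →₀ ℕ) →+ E)
    (q : Option ι → MvPolynomial ι (MvPolynomial σ K)) (c₀ : σ → K)
    (hind : AlgebraicIndependent K (fun i => map (eval c₀) (q (some i))))
    (f : MvPolynomial (Option ι) K) (hf0 : f ≠ 0)
    (hf : aeval (fun o => map (eval c₀) (q o)) f = 0)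
    (hmin : ∀ h : MvPolynomial (Option ι) K, h ≠ 0 → aeval (fun o => map (eval c₀) (q o)) h = 0 →
      f.totalDegree ≤ h.totalDegree) :
    ∃ P : MvPolynomial σ K, P ≠ 0 ∧ ∀ c : σ → K, eval c P ≠ 0 →
      AlgebraicIndependent K (fun i => map (eval c) (q (some i))) ∧
      (∃ h : MvPolynomial (Option ι) K, h ≠ 0 ∧ aeval (fun o => map (eval c) (q o)) h = 0) ∧
      ∀ f' : MvPolynomial (Option ι) K, f' ≠ 0 → aeval (fun o => map (eval c) (q o)) f' = 0 →
        (∀ h : MvPolynomial (Option ι) K, h ≠ 0 → aeval (fun o => map (eval c) (q o)) h = 0 →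
          f'.totalDegree ≤ h.totalDegree) →
        ∃ v : Option ι →₀ ℕ, ∀ e ∈ f.support,
          w e + w v ∈ convexHull ℝ (w '' (f'.support : Set (Option ι →₀ ℕ))) := by
  classical
  have hgen : AlgebraicIndependent (MvPolynomial σ K) (fun i => q (some i)) := by
    rw [algebraicIndependent_iff]
    intro h hh
    by_contra hne
    obtain ⟨h₀, hh0, -, hr⟩ := exists_specialized_relation _ h hne hh c₀
    exact hh0 (hind.eq_zero_of_aeval_eq_zero _ hr)
  have hdep : ∃ F : MvPolynomial (Option ι) (MvPolynomial σ K), F ≠ 0 ∧ aeval q F = 0 := by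
    by_contra! H
    have h1 : AlgebraicIndependent (MvPolynomial σ K) q := by
      rw [algebraicIndependent_iff]
      intro h hh
      by_contra hne
      exact H h hne hh
    have h2 := h1.lift_cardinalMk_le_trdeg
    rw [trdeg_of_isDomain] at h2
    simp only [Cardinal.mk_fintype, Cardinal.lift_natCast, Nat.cast_le, Fintype.card_option] at h2
    omega
  obtain ⟨F, hF0, hF, hFmin⟩ := exists_relation_minimal_totalDegree q hdep
  obtain ⟨P₁, hP₁, hdeg⟩ := exists_forall_le_totalDegree_of_map_ne_zero (B := K) q F.totalDegree hFmin
  obtain ⟨P₂, hP₂, hindep⟩ := exists_forall_algebraicIndependent_of_map_ne_zero (L := K) _ hgen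
  obtain ⟨F₀, hF₀0, hF₀supp, hF₀⟩ := exists_specialized_relation q F hF0 hF c₀
  obtain ⟨r, hr⟩ := dvd_of_minimal_relation (fun o => map (eval c₀) (q o)) hind f hf0 hf hmin F₀ hF₀
  obtain ⟨v, hv⟩ : r.support.Nonempty := by
    rw [Finset.nonempty_iff_ne_empty, Ne, support_eq_empty]
    rintro rfl
    exact hF₀0 (by rw [hr, mul_zero])
  refine ⟨P₁ * P₂ * ∏ m ∈ F.support, coeff m F, mul_ne_zero (mul_ne_zero hP₁ hP₂)
    (Finset.prod_ne_zero_iff.2 fun m hm => mem_support_iff.1 hm), fun c hc => ?_⟩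
  rw [map_mul, map_mul, map_prod] at hc
  obtain ⟨hc12, hc3⟩ := mul_ne_zero_iff.1 hc
  obtain ⟨hc1, hc2⟩ := mul_ne_zero_iff.1 hc12
  rw [Finset.prod_ne_zero_iff] at hc3
  have hsupp : (map (eval c) F).support = F.support := by
    refine (support_map_subset _ _).antisymm fun m hm => ?_
    rw [mem_support_iff, coeff_map]
    exact hc3 m hm
  have hFc0 : map (eval c) F ≠ 0 := by
    intro h
    rw [h, support_zero, eq_comm, support_eq_empty] at hsupp
    exact hF0 hsupp
  have hFc : aeval (fun o => map (eval c) (q o)) (map (eval c) F) = 0 := by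
    rw [aeval_map_map_comp, hF, map_zero]
  refine ⟨hindep _ hc2, ⟨_, hFc0, hFc⟩, fun f' hf'0 hf' hf'min => ⟨v, fun e he => ?_⟩⟩
  obtain ⟨s, hs⟩ := dvd_of_minimal_relation (fun o => map (eval c) (q o)) (hindep _ hc2) f' hf'0 hf'
    hf'min _ hFc
  have hs0 : s ≠ 0 := by rintro rfl; exact hFc0 (by rw [hs, mul_zero])
  have hsdeg : s.totalDegree = 0 := by
    have h1 := hdeg (eval c) hc1 f' hf'0 hf'
    have h2 : (map (eval c) F).totalDegree ≤ F.totalDegree := by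
      rw [totalDegree, totalDegree, hsupp]
    rw [hs, totalDegree_mul_of_isDomain hf'0 hs0] at h2
    omega
  have hss : f'.support = F.support := by
    rw [← hsupp, hs, (totalDegree_eq_zero_iff_eq_C).1 hsdeg]
    have : coeff 0 s ≠ 0 := by
      intro h0
      rw [totalDegree_eq_zero_iff_eq_C, h0, C_0] at hsdeg
      exact hs0 hsdeg
    ext m
    simp [mul_comm f', coeff_C_mul, this]
  refine convexHull_mono (Set.image_mono ?_) (add_mem_convexHull_support_mul w f r he hv)
  rw [← hr, hss]
  exact Finset.coe_subset.2 hF₀supp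

theorem diffDer_mem_sysIdeal {K : Type*} [CommRing K] {n : ℕ} {g : Fin n → MvPolynomial (Fin n) K}
    {h : MvPolynomial (Fin n × ℕ) K} (hh : h ∈ sysIdeal K n g) :
    diffDer K n h ∈ sysIdeal K n g := by
  unfold sysIdeal diffIdeal at hh ⊢
  induction hh using Submodule.span_induction with
  | mem x hx =>
    obtain ⟨f, hf, j, rfl⟩ := hx
    refine Ideal.subset_span ⟨f, hf, j + 1, ?_⟩
    rw [Function.iterate_succ_apply']
  | zero => simp
  | add x y _ _ hx hy => rw [map_add]; exact add_mem hx hy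
  | smul a x hx hdx =>
    rw [smul_eq_mul, Derivation.leibniz, smul_eq_mul, smul_eq_mul]
    exact add_mem (Ideal.mul_mem_left _ _ hdx) (Ideal.mul_mem_right _ _ hx)

theorem diffDer_rename_sub_mem_sysIdeal {K : Type*} [CommRing K] {n : ℕ}
    (g : Fin n → MvPolynomial (Fin n) K) (p : MvPolynomial (Fin n) K) :
    diffDer K n (rename (fun j => (j, 0)) p) - rename (fun j => (j, 0)) (mkDerivation K g p) ∈
      sysIdeal K n g := by
  induction p using MvPolynomial.induction_on with
  | C a => simp [derivation_C]
  | add p q hp hq =>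
    simp only [map_add]
    convert add_mem hp hq using 1
    ring
  | mul_X p i hp =>
    have h1 : (X (i, 1) - rename (fun j => (j, 0)) (g i) : MvPolynomial (Fin n × ℕ) K) ∈
        sysIdeal K n g := Ideal.subset_span ⟨_, ⟨i, rfl⟩, 0, rfl⟩
    convert add_mem (Ideal.mul_mem_left _ (rename (fun j => (j, 0)) p) h1)
      (Ideal.mul_mem_left _ (X (i, 0)) hp) using 1
    simp only [map_mul, rename_X, Derivation.leibniz, smul_eq_mul, mkDerivation_X, map_add]
    rw [show diffDer K n (X (i, 0)) = X (i, 1) from mkDerivation_X _ _ _]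
    ring

theorem X_sub_rename_mem_sysIdeal {K : Type*} [CommRing K] {n : ℕ}
    (g : Fin n → MvPolynomial (Fin n) K) (i : Fin n) (j : ℕ) :
    X (i, j) - rename (fun j => (j, 0)) ((mkDerivation K g)^[j] (X i)) ∈ sysIdeal K n g := by
  induction j with
  | zero => simp
  | succ j ih =>
    convert add_mem (diffDer_mem_sysIdeal ih)
      (diffDer_rename_sub_mem_sysIdeal g ((mkDerivation K g)^[j] (X i))) using 1
    rw [Function.iterate_succ_apply', map_sub,
      show diffDer K n (X (i, j)) = X (i, j + 1) from mkDerivation_X _ _ _]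
    ring

/-- A differential polynomial lies in the ideal of the system `x' = g(x)` iff it vanishes after
replacing each `x_i^{(j)}` by the `j`-th Lie derivative of `x_i` along `g`. -/
theorem mem_sysIdeal_iff {K : Type*} [CommRing K] {n : ℕ} (g : Fin n → MvPolynomial (Fin n) K)
    (h : MvPolynomial (Fin n × ℕ) K) :
    h ∈ sysIdeal K n g ↔
      aeval (fun v : Fin n × ℕ => (mkDerivation K g)^[v.2] (X v.1)) h = 0 := by
  let φ : MvPolynomial (Fin n × ℕ) K →ₐ[K] MvPolynomial (Fin n) K :=
    aeval fun v : Fin n × ℕ => (mkDerivation K g)^[v.2] (X v.1)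
  have hφX : ∀ v, φ (X v) = (mkDerivation K g)^[v.2] (X v.1) := fun v => aeval_X _ _
  have hsemi : Function.Semiconj φ (diffDer K n) (mkDerivation K g) := by
    intro p
    induction p using MvPolynomial.induction_on with
    | C a => rw [derivation_C, map_zero, ← algebraMap_eq, φ.commutes, Derivation.map_algebraMap]
    | add p q hp hq => simp only [map_add, hp, hq]
    | mul_X p v hp =>
      simp only [map_mul, Derivation.leibniz, smul_eq_mul, map_add, hp]
      rw [show diffDer K n (X v) = X (v.1, v.2 + 1) from mkDerivation_X _ _ _, hφX, hφX,
        Function.iterate_succ_apply']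
  constructor
  · intro hh
    change φ h = 0
    unfold sysIdeal diffIdeal at hh
    rw [← RingHom.mem_ker]
    refine Ideal.span_le.2 ?_ hh
    rintro _ ⟨_, ⟨i, rfl⟩, j, rfl⟩
    have h0 : φ (X (i, 1) - rename (fun j => (j, 0)) (g i)) = 0 := by
      have h1 : φ (rename (fun j => (j, 0)) (g i)) = g i := by
        rw [aeval_rename]
        exact aeval_X_left_apply (g i)
      rw [map_sub, hφX, h1]
      simp
    rw [SetLike.mem_coe, RingHom.mem_ker, (hsemi.iterate_right j).eq, h0, iterate_map_zero]
  · intro hh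
    have h1 : (Ideal.Quotient.mkₐ K (sysIdeal K n g)).comp ((rename fun j => (j, 0)).comp φ) =
        Ideal.Quotient.mkₐ K (sysIdeal K n g) := by
      apply MvPolynomial.algHom_ext
      intro v
      simp only [AlgHom.comp_apply, hφX, Ideal.Quotient.mkₐ_eq_mk]
      exact (Ideal.Quotient.eq.2 (X_sub_rename_mem_sysIdeal g v.1 v.2)).symm
    have h2 := AlgHom.congr_fun h1 h
    rw [AlgHom.comp_apply, AlgHom.comp_apply, show φ h = 0 from hh, map_zero, map_zero] at h2
    exact Ideal.Quotient.eq_zero_iff_mem.1 h2.symm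

theorem MvPolynomial.map_iterate_mkDerivation {A B τ : Type*} [CommRing A] [CommRing B]
    (φ : A →+* B) (G : τ → MvPolynomial τ A) (k : ℕ) (p : MvPolynomial τ A) :
    map φ ((mkDerivation A G)^[k] p) =
      (mkDerivation B fun i => map φ (G i))^[k] (map φ p) := by
  refine (Function.Semiconj.iterate_right (f := map φ) (ga := mkDerivation A G) (fun p => ?_) k).eq p
  induction p using MvPolynomial.induction_on with
  | C a => simp [derivation_C]
  | add p q hp hq => simp only [map_add, hp, hq]
  | mul_X p i hp => simp [Derivation.leibniz, hp]

theorem MvPolynomial.totalDegree_rename_of_injective {R ι τ : Type*} [CommSemiring R] {e : ι → τ}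
    (he : Function.Injective e) (p : MvPolynomial ι R) :
    (rename e p).totalDegree = p.totalDegree := by
  classical
  refine (totalDegree_rename_le e p).antisymm (Finset.sup_le fun m hm => ?_)
  have h1 : m.mapDomain e ∈ (rename e p).support := by
    rw [support_rename_of_injective he]
    exact Finset.mem_image_of_mem _ hm
  refine le_trans (le_of_eq ?_) (le_totalDegree h1)
  rw [Finsupp.sum_mapDomain_index (fun _ => rfl) fun _ _ _ => rfl]

/-- The variables `x_1, x_1', …, x_1^{(n)}`, the last one being indexed by `none`. -/
def jetVar (n : ℕ) [NeZero n] (o : Option (Fin n)) : Fin n × ℕ := (0, o.elim n Fin.val)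

theorem jetVar_injective (n : ℕ) [NeZero n] : Function.Injective (jetVar n) := by
  rintro (_ | i) (_ | j) h
  · rfl
  · exact absurd (congrArg Prod.snd h).symm j.2.ne
  · exact absurd (congrArg Prod.snd h) i.2.ne
  · exact congrArg some (Fin.ext (congrArg Prod.snd h))

theorem jetVar_snd_le (n : ℕ) [NeZero n] (o : Option (Fin n)) : (jetVar n o).2 ≤ n := by
  rcases o with _ | i
  · exact le_rfl
  · exact i.2.le

theorem fst_eq_zero_of_mem_vars_rename_jetVar {K : Type*} [CommSemiring K] {n : ℕ} [NeZero n]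
    (h : MvPolynomial (Option (Fin n)) K) : ∀ v ∈ (rename (jetVar n) h).vars, v.1 = 0 := by
  intro v hv
  obtain ⟨o, -, rfl⟩ := mem_vars_rename _ _ hv
  rfl

theorem ordOf_rename_jetVar_le {K : Type*} [CommSemiring K] {n : ℕ} [NeZero n]
    (h : MvPolynomial (Option (Fin n)) K) : ordOf (rename (jetVar n) h) ≤ n := by
  refine Finset.sup_le fun v hv => ?_
  obtain ⟨o, -, rfl⟩ := mem_vars_rename _ _ hv
  exact jetVar_snd_le n o

theorem exists_rename_jetVar_eq {K : Type*} [CommSemiring K] {n : ℕ} [NeZero n]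
    (p : MvPolynomial (Fin n × ℕ) K) (hp : ∀ v ∈ p.vars, v.1 = 0) (hord : ordOf p ≤ n) :
    ∃ h : MvPolynomial (Option (Fin n)) K, rename (jetVar n) h = p := by
  refine exists_rename_eq_of_vars_subset_range p _ (jetVar_injective n) ?_
  intro v hv
  have h1 : v.2 ≤ n := (Finset.le_sup (f := Prod.snd) hv).trans hord
  rcases h1.lt_or_eq with h2 | h2
  · exact ⟨some ⟨v.2, h2⟩, Prod.ext (hp v hv).symm rfl⟩
  · exact ⟨none, Prod.ext (hp v hv).symm h2.symm⟩

/-- The Lie derivatives of `x_1` along `g` of orders `0, …, n`. -/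
def jetLie {K : Type*} [CommRing K] {n : ℕ} [NeZero n] (g : Fin n → MvPolynomial (Fin n) K)
    (o : Option (Fin n)) : MvPolynomial (Fin n) K :=
  (mkDerivation K g)^[(jetVar n o).2] (X 0)

theorem rename_jetVar_mem_sysIdeal_iff {K : Type*} [CommRing K] {n : ℕ} [NeZero n]
    (g : Fin n → MvPolynomial (Fin n) K) (h : MvPolynomial (Option (Fin n)) K) :
    rename (jetVar n) h ∈ sysIdeal K n g ↔ aeval (jetLie g) h = 0 := by
  rw [mem_sysIdeal_iff, aeval_rename]
  rfl

/-- The first `n` Lie derivatives of `x_1` are independent iff the elimination ideal has no nonzero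
element of order less than `n`. -/
theorem algebraicIndependent_jetLie_iff {K : Type*} [Field K] {n : ℕ} [NeZero n]
    (g : Fin n → MvPolynomial (Fin n) K) :
    AlgebraicIndependent K (fun i => jetLie g (some i)) ↔
      ∀ p : MvPolynomial (Fin n × ℕ) K, p ≠ 0 → p ∈ sysIdeal K n g → (∀ v ∈ p.vars, v.1 = 0) →
        n ≤ ordOf p := by
  have hrel : ∀ h : MvPolynomial (Fin n) K, rename (jetVar n) (rename some h) ∈ sysIdeal K n g ↔
      aeval (fun i => jetLie g (some i)) h = 0 := by
    intro h
    rw [rename_jetVar_mem_sysIdeal_iff, aeval_rename]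
    rfl
  constructor
  · intro hind p hp0 hp hvars
    by_contra! hlt
    have h1 : ↑p.vars ⊆ Set.range (jetVar n ∘ some) := by
      intro v hv
      exact ⟨⟨v.2, (Finset.le_sup (f := Prod.snd) hv).trans_lt hlt⟩,
        Prod.ext (hvars v hv).symm rfl⟩
    obtain ⟨h, rfl⟩ := exists_rename_eq_of_vars_subset_range p _
      ((jetVar_injective n).comp (Option.some_injective _)) h1
    rw [← rename_rename, hrel] at hp
    rw [hind.eq_zero_of_aeval_eq_zero h hp, map_zero] at hp0
    exact hp0 rfl
  · intro H
    rw [algebraicIndependent_iff]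
    intro h hh
    by_contra hne
    have h1 := H _ ((map_ne_zero_iff _ (rename_injective _ (jetVar_injective n))).2
      ((map_ne_zero_iff _ (rename_injective _ (Option.some_injective _))).2 hne))
      ((hrel h).2 hh) (fst_eq_zero_of_mem_vars_rename_jetVar _)
    refine absurd h1 (not_le.2 ((Finset.sup_lt_iff (NeZero.pos n)).2 fun v hv => ?_))
    rw [rename_rename] at hv
    obtain ⟨i, -, rfl⟩ := mem_vars_rename _ _ hv
    exact i.2

/-- A minimal polynomial of order `n` is a minimal relation between the first `n + 1` Lie
derivatives. -/
theorem IsMinPoly.exists_relation {K : Type*} [Field K] {n : ℕ} [NeZero n]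
    {g : Fin n → MvPolynomial (Fin n) K} {f : MvPolynomial (Fin n × ℕ) K}
    (hf : IsMinPoly K n (sysIdeal K n g) f) (hord : ordOf f = n) :
    ∃ f₁ : MvPolynomial (Option (Fin n)) K, rename (jetVar n) f₁ = f ∧ f₁ ≠ 0 ∧
      aeval (jetLie g) f₁ = 0 ∧ ∀ h : MvPolynomial (Option (Fin n)) K, h ≠ 0 →
        aeval (jetLie g) h = 0 → f₁.totalDegree ≤ h.totalDegree := by
  obtain ⟨hf0, hfI, hvars, hmin⟩ := hf
  obtain ⟨f₁, rfl⟩ := exists_rename_jetVar_eq f hvars hord.le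
  refine ⟨f₁, rfl, fun h => hf0 (by rw [h, map_zero]),
    (rename_jetVar_mem_sysIdeal_iff g f₁).1 hfI, fun h h0 hh => ?_⟩
  have h1 := (hmin _ ((map_ne_zero_iff _ (rename_injective _ (jetVar_injective n))).2 h0)
    ((rename_jetVar_mem_sysIdeal_iff g h).2 hh) (fst_eq_zero_of_mem_vars_rename_jetVar h)).2
    (by rw [hord]; exact ordOf_rename_jetVar_le h)
  rwa [totalDegree_rename_of_injective (jetVar_injective n),
    totalDegree_rename_of_injective (jetVar_injective n)] at h1

theorem isMinPoly_rename_jetVar {K : Type*} [Field K] {n : ℕ} [NeZero n]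
    {g : Fin n → MvPolynomial (Fin n) K}
    (hind : AlgebraicIndependent K (fun i => jetLie g (some i)))
    {f : MvPolynomial (Option (Fin n)) K} (hf0 : f ≠ 0) (hf : aeval (jetLie g) f = 0)
    (hmin : ∀ h : MvPolynomial (Option (Fin n)) K, h ≠ 0 → aeval (jetLie g) h = 0 →
      f.totalDegree ≤ h.totalDegree) :
    IsMinPoly K n (sysIdeal K n g) (rename (jetVar n) f) := by
  refine ⟨(map_ne_zero_iff _ (rename_injective _ (jetVar_injective n))).2 hf0,
    (rename_jetVar_mem_sysIdeal_iff g f).2 hf, fst_eq_zero_of_mem_vars_rename_jetVar f,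
    fun p hp0 hp hvars => ⟨(ordOf_rename_jetVar_le f).trans
      ((algebraicIndependent_jetLie_iff g).1 hind p hp0 hp hvars), fun hle => ?_⟩⟩
  obtain ⟨h, rfl⟩ := exists_rename_jetVar_eq p hvars (hle.trans (ordOf_rename_jetVar_le f))
  rw [totalDegree_rename_of_injective (jetVar_injective n),
    totalDegree_rename_of_injective (jetVar_injective n)]
  exact hmin h (fun h0 => hp0 (by rw [h0, map_zero])) ((rename_jetVar_mem_sysIdeal_iff g h).1 hp)

/-- The real exponent vector `(e_0, …, e_n)` of a monomial in the variables `jetVar n`. -/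
def jetExp (n : ℕ) [NeZero n] : (Option (Fin n) →₀ ℕ) →+ (Fin (n + 1) → ℝ) where
  toFun m k := m.mapDomain (jetVar n) (0, (k : ℕ))
  map_zero' := by ext; simp
  map_add' a b := by ext; simp [Finsupp.mapDomain_add]

theorem expVecs_rename_jetVar {K : Type*} [CommSemiring K] {n : ℕ} [NeZero n]
    (f : MvPolynomial (Option (Fin n)) K) :
    expVecs K n n (rename (jetVar n) f) =
      jetExp n '' (f.support : Set (Option (Fin n) →₀ ℕ)) := by
  classical
  ext e
  simp only [expVecs, support_rename_of_injective (jetVar_injective n), Finset.mem_image,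
    Set.mem_ofPred_eq, Set.mem_image, Finset.mem_coe]
  constructor
  · rintro ⟨_, ⟨m, hm, rfl⟩, rfl⟩
    exact ⟨m, hm, rfl⟩
  · rintro ⟨m, hm, rfl⟩
    exact ⟨_, ⟨m, hm, rfl⟩, rfl⟩

/-- A pair `(i, m)` for which the coefficient of `x^m` in the `i`-th polynomial is free. -/
abbrev CoeffIndex {n : ℕ} (P' : Fin n → Set (Fin n → ℝ)) : Type :=
  {p : Fin n × (Fin n →₀ ℕ) // (fun j => (p.2 j : ℝ)) ∈ P' p.1}

theorem finite_coeffIndex {n : ℕ} {P' : Fin n → Set (Fin n → ℝ)}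
    (hP : ∀ i, Bornology.IsBounded (P' i)) : Finite (CoeffIndex P') := by
  have hfin : ∀ i, {m : Fin n →₀ ℕ | (fun j => (m j : ℝ)) ∈ P' i}.Finite := by
    intro i
    obtain ⟨R, hR⟩ := (hP i).exists_norm_le
    refine (Set.finite_Icc 0 (Finsupp.equivFunOnFinite.symm fun _ : Fin n => ⌈R⌉₊)).subset
      fun m hm => ⟨zero_le, fun j => ?_⟩
    have h1 : ‖(m j : ℝ)‖ ≤ R := (norm_le_pi_norm (fun j => (m j : ℝ)) j).trans (hR _ hm)
    rw [Real.norm_natCast] at h1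
    exact_mod_cast h1.trans (Nat.le_ceil R)
  refine Set.Finite.to_subtype ((Set.finite_iUnion fun i => (hfin i).image (Prod.mk i)).subset ?_)
  rintro ⟨i, m⟩ h
  exact Set.mem_iUnion.2 ⟨i, m, h, rfl⟩

/-- The system with indeterminate coefficients at the monomials supported in `P'`. -/
def genericSystem (K : Type*) [CommRing K] {n : ℕ} (P' : Fin n → Set (Fin n → ℝ))
    [Fintype (CoeffIndex P')] (i : Fin n) :
    MvPolynomial (Fin n) (MvPolynomial (CoeffIndex P') K) :=
  ∑ s : CoeffIndex P', if s.1.1 = i then monomial s.1.2 (X s) else 0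

theorem map_eval_genericSystem {K : Type*} [CommRing K] {n : ℕ} {P' : Fin n → Set (Fin n → ℝ)}
    [Fintype (CoeffIndex P')] (g : Fin n → MvPolynomial (Fin n) K)
    (hg : ∀ i, ∀ m : Fin n →₀ ℕ, coeff m (g i) ≠ 0 → (fun j => (m j : ℝ)) ∈ P' i) (i : Fin n) :
    map (eval fun s : CoeffIndex P' => coeff s.1.2 (g s.1.1)) (genericSystem K P' i) = g i := by
  classical
  ext m
  have hterm : ∀ s : CoeffIndex P', coeff m (map (eval fun s : CoeffIndex P' =>
      coeff s.1.2 (g s.1.1)) (if s.1.1 = i then monomial s.1.2 (X s) else 0)) =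
      if s.1 = (i, m) then coeff m (g i) else 0 := by
    rintro ⟨⟨i', m'⟩, hs⟩
    by_cases h1 : i' = i
    · subst h1
      by_cases h2 : m' = m
      · subst h2; simp
      · simp [coeff_monomial, h2]
    · simp [h1]
  rw [genericSystem, map_sum, coeff_sum, Finset.sum_congr rfl fun s _ => hterm s]
  by_cases h0 : coeff m (g i) = 0
  · simp [h0]
  · rw [Finset.sum_eq_single ⟨(i, m), hg i m h0⟩]
    · simp
    · intro s _ hs
      exact if_neg fun h => hs (Subtype.ext h)
    · simp

theorem map_jetLie {A B : Type*} [CommRing A] [CommRing B] (φ : A →+* B) {n : ℕ} [NeZero n]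
    (G : Fin n → MvPolynomial (Fin n) A) (o : Option (Fin n)) :
    map φ (jetLie G o) = jetLie (fun i => map φ (G i)) o := by
  rw [jetLie, map_iterate_mkDerivation, map_X, jetLie]

theorem statement12 (K : Type*) [Field K] [CharZero K] (n : ℕ) [NeZero n]
    (P' : Fin n → Set (Fin n → ℝ))
    (hpoly : ∀ i, ∃ s : Finset (Fin n → ℝ), P' i = convexHull ℝ (s : Set (Fin n → ℝ)))
    (hnonneg : ∀ i, P' i ⊆ {v | ∀ j, 0 ≤ v j})
    (g₀ : Fin n → MvPolynomial (Fin n) K)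
    (hsupp : ∀ i, ∀ m : Fin n →₀ ℕ, MvPolynomial.coeff m (g₀ i) ≠ 0 →
      (fun j => (m j : ℝ)) ∈ P' i)
    (f : MvPolynomial (Fin n × ℕ) K)
    (hf : IsMinPoly K n (sysIdeal K n g₀) f) (hordf : ordOf f = n) :
    ∃ P : MvPolynomial (Fin n × (Fin n →₀ ℕ)) K, P ≠ 0 ∧
      (∀ i : Fin n, ∀ m : Fin n →₀ ℕ, (i, m) ∈ P.vars → (fun j => (m j : ℝ)) ∈ P' i) ∧
      ∀ g : Fin n → MvPolynomial (Fin n) K,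
        (∀ i, ∀ m : Fin n →₀ ℕ, MvPolynomial.coeff m (g i) ≠ 0 →
          (fun j => (m j : ℝ)) ∈ P' i) →
        MvPolynomial.eval (fun p : Fin n × (Fin n →₀ ℕ) =>
          MvPolynomial.coeff p.2 (g p.1)) P ≠ 0 →
        (∃ f', IsMinPoly K n (sysIdeal K n g) f') ∧
        ∀ f' : MvPolynomial (Fin n × ℕ) K, IsMinPoly K n (sysIdeal K n g) f' →
          ordOf f' = n ∧
          ∃ v : Fin (n + 1) → ℝ, (∀ k, 0 ≤ v k) ∧
            (fun e => v + e) '' newtonPolytope K n n f ⊆ newtonPolytope K n n f' := by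
  have hbdd : ∀ i, Bornology.IsBounded (P' i) := by
    intro i
    obtain ⟨s, hs⟩ := hpoly i
    rw [hs, isBounded_convexHull]
    exact s.finite_toSet.isBounded
  have := finite_coeffIndex hbdd
  let _ : Fintype (CoeffIndex P') := Fintype.ofFinite _
  have hspec : ∀ g : Fin n → MvPolynomial (Fin n) K,
      (∀ i, ∀ m : Fin n →₀ ℕ, coeff m (g i) ≠ 0 → (fun j => (m j : ℝ)) ∈ P' i) → ∀ o,
      map (eval fun s : CoeffIndex P' => coeff s.1.2 (g s.1.1)) (jetLie (genericSystem K P') o) =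
        jetLie g o := by
    intro g hg o
    rw [map_jetLie]
    congr 1
    exact funext (map_eval_genericSystem g hg)
  obtain ⟨f₁, rfl, hf₁0, hf₁, hf₁min⟩ := hf.exists_relation hordf
  have hind₀ : AlgebraicIndependent K (fun i => jetLie g₀ (some i)) :=
    (algebraicIndependent_jetLie_iff g₀).2 fun p hp0 hp hvars =>
      hordf.symm.le.trans (hf.2.2.2 p hp0 hp hvars).1
  obtain ⟨P, hP0, hP⟩ := exists_generic_minimal_relation (jetExp n) (jetLie (genericSystem K P'))
    (fun s => coeff s.1.2 (g₀ s.1.1)) (by simpa only [hspec g₀ hsupp] using hind₀) f₁ hf₁0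
    (by simpa only [hspec g₀ hsupp] using hf₁) (by simpa only [hspec g₀ hsupp] using hf₁min)
  refine ⟨rename Subtype.val P,
    (map_ne_zero_iff _ (rename_injective _ Subtype.val_injective)).2 hP0, fun i m him => ?_,
    fun g hg hgP => ?_⟩
  · obtain ⟨s, -, hs⟩ := mem_vars_rename _ _ him
    have := s.2
    rwa [hs] at this
  rw [eval_rename] at hgP
  obtain ⟨hind, hdep, htrans⟩ := hP (fun s => coeff s.1.2 (g s.1.1)) hgP
  simp only [hspec g hg] at hind hdep htrans
  obtain ⟨h, hh0, hh, hhmin⟩ := exists_relation_minimal_totalDegree (jetLie g) hdep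
  have hmin := isMinPoly_rename_jetVar hind hh0 hh hhmin
  refine ⟨⟨_, hmin⟩, fun f' hf' => ?_⟩
  have hord : ordOf f' = n := le_antisymm
    ((hf'.2.2.2 _ hmin.1 hmin.2.1 hmin.2.2.1).1.trans (ordOf_rename_jetVar_le h))
    ((algebraicIndependent_jetLie_iff g).1 hind f' hf'.1 hf'.2.1 hf'.2.2.1)
  obtain ⟨f₂, rfl, hf₂0, hf₂, hf₂min⟩ := hf'.exists_relation hord
  obtain ⟨v, hv⟩ := htrans f₂ hf₂0 hf₂ hf₂min
  refine ⟨hord, jetExp n v, fun k => Nat.cast_nonneg _, ?_⟩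
  rw [newtonPolytope, newtonPolytope, expVecs_rename_jetVar, expVecs_rename_jetVar,
    Set.image_subset_iff]
  refine convexHull_min ?_ ((convex_convexHull ℝ _).translate_preimage_right _)
  rintro _ ⟨e, he, rfl⟩
  rw [Set.mem_preimage, add_comm (jetExp n v)]
  exact hv e he
end
end

section
/- Let K be a field of characteristic zero with algebraic closure K̄, let n, d, D be positive integers, and let γ = (γ_1, ..., γ_n) ∈ ℤ_{≥0}^n with γ_1 < γ_2 < ⋯ < γ_n. For α = (α_1, ..., α_n) ∈ K̄^n consider the square system of n equations in the unknowns (x_1, ..., x_n): Σ_{j=1}^{n} α_j^{γ_i} x_j^{d + γ_i(D−1)} = 0 for i = 1, ..., n. Then there exists a nonempty Zariski open subset U ⊂ K̄^n such that for every α ∈ U this system has no solution in K̄^n other than the zero solution. -/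
open MvPolynomial

noncomputable section

theorem LinearIndependent.exists_algebraMap_eq_of_sum_mul_eq {L Ω β κ : Type*} [Field L] [Field Ω]
    [Algebra L Ω] [Fintype β] [Fintype κ] (v : β → κ → L)
    (hv : LinearIndependent Ω fun j i ↦ algebraMap L Ω (v j i)) (c : β → Ω) (w : κ → L)
    (h : ∀ i, ∑ j, c j * algebraMap L Ω (v j i) = algebraMap L Ω (w i)) (j : β) :
    ∃ a : L, algebraMap L Ω a = c j := by
  classical
  have hvL : LinearIndependent L v := by
    rw [Fintype.linearIndependent_iff] at hv ⊢
    intro g hg j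
    have := hv (fun j ↦ algebraMap L Ω (g j)) (by
      ext i
      have := congrArg (algebraMap L Ω) (congrFun hg i)
      simpa [Algebra.smul_def] using this) j
    simpa using this
  obtain ⟨f, hf⟩ := LinearMap.exists_leftInverse_of_injective (Fintype.linearCombination L v)
    (LinearMap.ker_eq_bot.2 (hvL.fintypeLinearCombination_injective))
  have hfv (l : β) : ∑ i, v l i * f (Pi.single i 1) j = if j = l then 1 else 0 := by
    have h1 := congrFun (LinearMap.congr_fun hf (Pi.single l 1)) j
    rw [LinearMap.comp_apply, Fintype.linearCombination_apply_single, one_smul,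
      LinearMap.pi_apply_eq_sum_univ f (v l)] at h1
    have h2 (i : κ) : (Pi.single i 1 : κ → L) = fun l ↦ if i = l then 1 else 0 :=
      funext fun l ↦ by simp [Pi.single_apply, eq_comm]
    simpa [h2, Pi.single_apply] using h1
  refine ⟨∑ i, w i * f (Pi.single i 1) j, ?_⟩
  simp_rw [map_sum, map_mul, ← h, Finset.sum_mul]
  rw [Finset.sum_comm]
  simp_rw [mul_assoc, ← map_mul, ← Finset.mul_sum, ← map_sum, hfv]
  simp

theorem exists_ne_zero_forall_sum_mul_eq_zero {L β κ : Type*} [Field L] [Fintype β] [Fintype κ]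
    (hcard : Fintype.card β < Fintype.card κ) (v : β → κ → L) :
    ∃ a : κ → L, a ≠ 0 ∧ ∀ j, ∑ i, a i * v j i = 0 := by
  have hker := LinearMap.ker_ne_bot_of_finrank_lt (f := (Matrix.of v).mulVecLin) (by simpa)
  obtain ⟨a, ha, ha0⟩ := Submodule.exists_mem_ne_zero_of_ne_bot hker
  refine ⟨a, ha0, fun j ↦ ?_⟩
  have := congrFun ha j
  simpa [Matrix.mulVec, dotProduct, mul_comm] using this

theorem isAlgebraic_of_pow_mem_span {L Ω β κ : Type*} [Field L] [Field Ω]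
    [Algebra L Ω] [Fintype β] [Fintype κ] (hcard : Fintype.card β < Fintype.card κ)
    {γ : κ → ℕ} (hγ : Function.Injective γ) (v : β → κ → L) {t : Ω}
    (ht : (fun i ↦ t ^ γ i) ∈ Submodule.span Ω (Set.range fun j i ↦ algebraMap L Ω (v j i))) :
    IsAlgebraic L t := by
  obtain ⟨a, ha, hav⟩ := exists_ne_zero_forall_sum_mul_eq_zero hcard v
  refine ⟨∑ i, Polynomial.monomial (γ i) (a i), fun h0 ↦ ha ?_, ?_⟩
  · ext i
    have := congrArg (fun p ↦ Polynomial.coeff p (γ i)) h0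
    classical
    simpa only [Polynomial.finsetSum_coeff, Polynomial.coeff_monomial, hγ.eq_iff,
      Finset.sum_ite_eq', Finset.mem_univ, if_true, Polynomial.coeff_zero, Pi.zero_apply] using this
  · obtain ⟨b, hb⟩ := (Submodule.mem_span_range_iff_exists_fun Ω).1 ht
    have hb' (i : κ) : t ^ γ i = ∑ j, b j * algebraMap L Ω (v j i) := by
      simpa using (congrFun hb i).symm
    simp_rw [map_sum, Polynomial.aeval_monomial, hb', Finset.mul_sum]
    rw [Finset.sum_comm]
    simp_rw [mul_left_comm, ← map_mul, ← Finset.mul_sum, ← map_sum, hav]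
    simp

theorem exists_encard_lt_forall_mem_of_sum_mul_pow_eq_zero (k : Type*) {Ω ι κ : Type*} [Field k]
    [Field Ω] [Algebra k Ω] [Fintype ι] [Fintype κ] (hcard : Fintype.card ι ≤ Fintype.card κ)
    {γ : κ → ℕ} (hγ : Function.Injective γ) {t c : ι → Ω}
    (h : ∀ i, ∑ j, c j * t j ^ γ i = 0) {j₀ : ι} (hj₀ : c j₀ = 1) :
    ∃ T : Set Ω, T.encard < Fintype.card ι ∧ ∀ L : IntermediateField k Ω,
      (∀ a : Ω, IsAlgebraic L a → a ∈ L) → T ⊆ L → ∀ j, t j ∈ L ∧ c j ∈ L := by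
  classical
  let v : ι → κ → Ω := fun j i ↦ t j ^ γ i
  obtain ⟨B, hB, -, hspan, hind⟩ := exists_linearIndepOn_extension (K := Ω) (v := v)
    (linearIndepOn_empty Ω v) (Set.empty_subset {j₀}ᶜ)
  have hj₀B : j₀ ∉ B := fun hj ↦ hB hj rfl
  have hmem (j : ι) : v j ∈ Submodule.span Ω (v '' B) := by
    by_cases hj : j = j₀
    · subst hj
      have : v j = -∑ l ∈ Finset.univ.erase j, c l • v l := by
        rw [eq_neg_iff_add_eq_zero]
        ext i
        have := h i
        rw [← Finset.add_sum_erase _ _ (Finset.mem_univ j), hj₀] at this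
        simpa [v] using this
      rw [this]
      refine Submodule.neg_mem _ (Submodule.sum_mem _ fun l hl ↦ Submodule.smul_mem _ _ (hspan ?_))
      exact ⟨l, Finset.ne_of_mem_erase hl, rfl⟩
    · exact hspan ⟨j, hj, rfl⟩
  have hBcard : Fintype.card B < Fintype.card ι := Fintype.card_subtype_lt hj₀B
  refine ⟨t '' B ∪ c '' (insert j₀ B)ᶜ, ?_, fun L hL hT ↦ ?_⟩
  · have h1 : (B ∪ (insert j₀ B)ᶜ).encard < Fintype.card ι := by
      have : B ∪ (insert j₀ B)ᶜ ⊂ Set.univ := by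
        refine Set.ssubset_univ_iff.2 fun hu ↦ ?_
        have : j₀ ∈ B ∪ (insert j₀ B)ᶜ := hu ▸ Set.mem_univ _
        simp [hj₀B] at this
      simpa using (Set.toFinite _).encard_lt_encard this
    refine lt_of_le_of_lt ?_ h1
    have hdisj : Disjoint B (insert j₀ B)ᶜ :=
      Set.disjoint_compl_right_iff_subset.2 (Set.subset_insert _ _)
    rw [Set.encard_union_eq hdisj]
    exact (Set.encard_union_le _ _).trans (add_le_add (Set.encard_image_le _ _)
      (Set.encard_image_le _ _))
  have htB (j : B) : t j ∈ L := hT (Or.inl ⟨j, j.2, rfl⟩)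
  have ht (j : ι) : t j ∈ L := by
    refine hL _ (isAlgebraic_of_pow_mem_span (hBcard.trans_le hcard) hγ
      (fun (j : B) i ↦ (⟨t j, htB j⟩ : L) ^ γ i) ?_)
    have := hmem j
    rwa [Set.image_eq_range] at this
  have hcB (j : ι) (hj : j ∉ B) : c j ∈ L := by
    by_cases hj' : j = j₀
    · rw [hj', hj₀]; exact L.one_mem
    · exact hT (Or.inr ⟨j, by simp [hj, hj'], rfl⟩)
  refine fun j ↦ ⟨ht j, ?_⟩
  by_cases hj : j ∈ B
  · obtain ⟨a, ha⟩ := LinearIndependent.exists_algebraMap_eq_of_sum_mul_eq (L := L)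
      (fun (j : B) i ↦ (⟨t j, ht j⟩ : L) ^ γ i) hind (fun j ↦ c j)
      (fun i ↦ -∑ l : {l // l ∉ B}, (⟨c l, hcB l l.2⟩ : L) * (⟨t l, ht l⟩ : L) ^ γ i)
      (fun i ↦ by
        have := h i
        rw [← Fintype.sum_subtype_add_sum_subtype (· ∈ B)] at this
        simpa [eq_neg_iff_add_eq_zero] using this) ⟨j, hj⟩
    exact ha ▸ a.2
  · exact hcB j hj

theorem not_algebraicIndependent_of_sum_eq_zero (k : Type*) {Ω ι κ : Type*} [Field k]
    [Field Ω] [Algebra k Ω] [Fintype ι] [Nonempty ι] [Fintype κ]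
    (hcard : Fintype.card ι ≤ Fintype.card κ) {γ : κ → ℕ} (hγ : Function.Injective γ)
    {d : ℕ} (hd : 0 < d) (e : ℕ) {α x : ι → Ω} (hx : ∀ j, x j ≠ 0)
    (h : ∀ i, ∑ j, α j ^ γ i * x j ^ (d + γ i * e) = 0) :
    ¬ AlgebraicIndependent k α := by
  intro hα
  obtain ⟨j₀⟩ := ‹Nonempty ι›
  let y : ι → Ω := fun j ↦ x j / x j₀
  have hy (j : ι) : y j ≠ 0 := div_ne_zero (hx j) (hx j₀)
  have hy₀ : y j₀ = 1 := div_self (hx j₀)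
  obtain ⟨T, hTcard, hT⟩ := exists_encard_lt_forall_mem_of_sum_mul_pow_eq_zero k hcard hγ
    (t := fun j ↦ α j * y j ^ e) (c := fun j ↦ y j ^ d) (j₀ := j₀) (fun i ↦ by
      have : ∀ j, y j ^ d * (α j * y j ^ e) ^ γ i =
          α j ^ γ i * x j ^ (d + γ i * e) / x j₀ ^ (d + γ i * e) := fun j ↦ by
        rw [mul_div_assoc, ← div_pow]
        change _ = _ * y j ^ _
        ring
      simp_rw [this, ← Finset.sum_div, h, zero_div]) (by simp [hy₀])
  let M := AlgebraicIndependent.matroid k Ω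
  obtain ⟨S, hS, hSalg⟩ := AlgebraicIndependent.matroid_isFlat_iff.1 (M.isFlat_closure T)
  let L : IntermediateField k Ω := S.toIntermediateField fun a ha ↦ by
    rw [← SetLike.mem_coe, hS]
    exact hSalg _ (IsAlgebraic.inv (isAlgebraic_algebraMap (⟨a, ha⟩ : S)))
  have hLS : (L : Set Ω) = M.closure T := hS
  have hL (a : Ω) (ha : IsAlgebraic L a) : a ∈ L := by
    rw [← SetLike.mem_coe, hLS]
    exact hSalg a ha
  have hαL : Set.range α ⊆ M.closure T := by
    rintro _ ⟨j, rfl⟩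
    obtain ⟨h1, h2⟩ := hT L hL (hLS ▸ M.subset_closure T) j
    have h3 : y j ∈ L := by
      refine hL _ (IsAlgebraic.of_pow hd ?_)
      exact isAlgebraic_algebraMap (⟨_, h2⟩ : L)
    rw [← hLS, SetLike.mem_coe]
    have := L.div_mem h1 (pow_mem h3 e)
    rwa [mul_div_cancel_right₀ _ (pow_ne_zero _ (hy j))] at this
  have hI : M.Indep (Set.range α) :=
    AlgebraicIndependent.matroid_indep_iff.2 hα.coe_range
  have := (hI.encard_le_eRk_of_subset hαL).trans ((M.eRk_closure_eq T).trans_le (M.eRk_le_encard T))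
  rw [← Set.image_univ, hα.injective.encard_image, Set.encard_univ,
    ENat.card_eq_coe_fintype_card] at this
  exact this.not_gt hTcard

theorem eq_zero_of_sum_eq_zero_of_injective {k Ω ι κ : Type*} [Field k] [Field Ω] [Fintype ι]
    [Fintype κ] (hcard : Fintype.card ι ≤ Fintype.card κ) {γ : κ → ℕ}
    (hγ : Function.Injective γ) {d : ℕ} (hd : 0 < d) (e : ℕ) (φ : MvPolynomial ι k →+* Ω)
    (hφ : Function.Injective φ) {x : ι → Ω}
    (h : ∀ i, ∑ j, φ (X j) ^ γ i * x j ^ (d + γ i * e) = 0) : x = 0 := by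
  classical
  by_contra hx0
  obtain ⟨j, hj⟩ := Function.ne_iff.1 hx0
  have : Nonempty {j // x j ≠ 0} := ⟨j, hj⟩
  let _ : Algebra k Ω := (φ.comp C).toAlgebra
  let ψ : MvPolynomial ι k →ₐ[k] Ω := { φ with commutes' := fun _ ↦ rfl }
  have hα : AlgebraicIndependent k fun j ↦ φ (X j) :=
    (algebraicIndependent_X ι k).map' (f := ψ) hφ
  refine not_algebraicIndependent_of_sum_eq_zero k (ι := {j // x j ≠ 0})
    ((Fintype.card_subtype_le _).trans hcard) hγ hd e (x := fun j ↦ x j) (fun j ↦ j.2)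
    (fun i ↦ ?_) (hα.comp _ Subtype.val_injective)
  have h1 := h i
  rw [← Fintype.sum_subtype_add_sum_subtype (fun j ↦ x j ≠ 0)] at h1
  have h2 : ∑ j : {j // ¬ x j ≠ 0}, φ (X j.1) ^ γ i * x j ^ (d + γ i * e) = 0 :=
    Finset.sum_eq_zero fun j _ ↦ by
      rw [not_not.1 j.2, zero_pow (by omega), mul_zero]
  rwa [h2, add_zero] at h1

theorem exists_ne_zero_forall_eval₂_eq_zero_imp {R σ κ : Type*} [CommRing R] [IsDomain R]
    [Finite σ] (F Ω : Type*) [Field F] [Algebra R F] [IsFractionRing R F] [Field Ω]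
    [IsAlgClosed Ω] [Algebra F Ω] (f : κ → MvPolynomial σ R)
    (hf : ∀ x : σ → Ω,
      (∀ i, eval₂ ((algebraMap F Ω).comp (algebraMap R F)) x (f i) = 0) → x = 0) :
    ∃ p : R, p ≠ 0 ∧ ∀ {A : Type*} [CommRing A] [IsDomain A] (φ : R →+* A), φ p ≠ 0 →
      ∀ x : σ → A, (∀ i, eval₂ φ x (f i) = 0) → x = 0 := by
  have := Fintype.ofFinite σ
  let I : Ideal (MvPolynomial σ R) := Ideal.span (Set.range f)
  let _ : Algebra (MvPolynomial σ R) (MvPolynomial σ F) := algebraMvPolynomial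
  have hX (j : σ) : ∃ p : R, p ≠ 0 ∧ ∃ N : ℕ, C p * X j ^ N ∈ I := by
    have hmem : (X j : MvPolynomial σ F) ∈ (I.map (algebraMap _ (MvPolynomial σ F))).radical := by
      rw [← vanishingIdeal_zeroLocus_eq_radical (K := Ω), mem_vanishingIdeal_iff]
      intro x hx
      have hx0 : x = 0 := hf x fun i ↦ by
        have := hx _ (Ideal.mem_map_of_mem _ (Ideal.subset_span (Set.mem_range_self i)))
        rwa [algebraMap_def, aeval_def, eval₂_map] at this
      simp [hx0]
    obtain ⟨N, hN⟩ := hmem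
    obtain ⟨⟨a, s⟩, has⟩ := (IsLocalization.mem_map_algebraMap_iff
      ((nonZeroDivisors R).map (C : R →+* MvPolynomial σ R)) (MvPolynomial σ F)).1 hN
    obtain ⟨p, hp, hps⟩ := s.2
    refine ⟨p, nonZeroDivisors.ne_zero hp, N, ?_⟩
    have : C p * X j ^ N = (a : MvPolynomial σ R) := by
      apply map_injective _ (IsFractionRing.injective R F)
      have h2 : (X j : MvPolynomial σ F) ^ N * map (algebraMap R F) (s : MvPolynomial σ R) =
        map (algebraMap R F) a := has
      rw [← h2, ← hps]
      simp [mul_comm]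
    exact this ▸ a.2
  choose p hp N hN using hX
  refine ⟨∏ j, p j, Finset.prod_ne_zero_iff.2 fun j _ ↦ hp j, fun φ hφ x hx ↦ funext fun j ↦ ?_⟩
  have hI : I ≤ RingHom.ker (eval₂Hom φ x) := Ideal.span_le.2 (Set.range_subset_iff.2 hx)
  have h0 : φ (p j) * x j ^ N j = 0 := by simpa using hI (hN j)
  rw [map_prod, Finset.prod_ne_zero_iff] at hφ
  exact eq_zero_of_pow_eq_zero ((mul_eq_zero.1 h0).resolve_left (hφ j (Finset.mem_univ j)))

theorem statement13 (K : Type*) [Field K] [CharZero K] (n d D : ℕ)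
    (hn : 0 < n) (hd : 0 < d) (hD : 0 < D)
    (γ : Fin n → ℕ) (hγ : StrictMono γ) :
    ∃ P : MvPolynomial (Fin n) (AlgebraicClosure K), P ≠ 0 ∧
      ∀ α : Fin n → AlgebraicClosure K, MvPolynomial.eval α P ≠ 0 →
        ∀ x : Fin n → AlgebraicClosure K,
          (∀ i : Fin n, ∑ j : Fin n, α j ^ γ i * x j ^ (d + γ i * (D - 1)) = 0) →
          x = 0 := by
  let F := FractionRing (MvPolynomial (Fin n) (AlgebraicClosure K))
  let f : Fin n → MvPolynomial (Fin n) (MvPolynomial (Fin n) (AlgebraicClosure K)) := fun i ↦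
    ∑ j, C (X j ^ γ i) * X j ^ (d + γ i * (D - 1))
  have hf {A : Type _} [CommRing A] (φ : MvPolynomial (Fin n) (AlgebraicClosure K) →+* A)
      (x : Fin n → A) (i : Fin n) :
      eval₂ φ x (f i) = ∑ j, φ (X j) ^ γ i * x j ^ (d + γ i * (D - 1)) := by
    simp [f, eval₂_sum]
  obtain ⟨P, hP, hPx⟩ := exists_ne_zero_forall_eval₂_eq_zero_imp F (AlgebraicClosure F) f
    fun x hx ↦ eq_zero_of_sum_eq_zero_of_injective le_rfl hγ.injective hd (D - 1) _
      ((algebraMap F (AlgebraicClosure F)).injective.comp (IsFractionRing.injective _ F))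
      fun i ↦ (hf _ x i).symm.trans (hx i)
  refine ⟨P, hP, fun α hα x hx ↦ hPx (eval α) hα x fun i ↦ ?_⟩
  simpa [hf] using hx i
end
end

section
/- Let K be a field of characteristic zero, let R be a commutative differential K-algebra with derivation 𝒟 : R → R. Fix a positive integer k and elements a, b ∈ R such that 𝒟(a) = a^k + b. Then for every n ≥ 1 the equality of ideals ⟨𝒟(a), 𝒟^2(a), ..., 𝒟^n(a)⟩ = ⟨𝒟(a), 𝒟(b), 𝒟^2(b), ..., 𝒟^{n−1}(b)⟩ holds in R. -/
noncomputable section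

section IteratedDerivation

variable {K R : Type*} [CommSemiring K] [CommRing R] [Algebra K R]

/-- A derivation maps the ideal spanned by the first `n` derivatives of `a` into the ideal spanned
by the first `n + 1` of them. -/
theorem Derivation.map_mem_span_iterate_succ (D : Derivation K R R) {a x : R} {n : ℕ}
    (hx : x ∈ Ideal.span {x : R | ∃ i ∈ Finset.Icc 1 n, x = (⇑D)^[i] a}) :
    D x ∈ Ideal.span {x : R | ∃ i ∈ Finset.Icc 1 (n + 1), x = (⇑D)^[i] a} := by
  have mono : Ideal.span {x : R | ∃ i ∈ Finset.Icc 1 n, x = (⇑D)^[i] a} ≤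
      Ideal.span {x : R | ∃ i ∈ Finset.Icc 1 (n + 1), x = (⇑D)^[i] a} := by
    refine Ideal.span_mono ?_
    rintro _ ⟨i, hi, rfl⟩
    exact ⟨i, Finset.Icc_subset_Icc_right n.le_succ hi, rfl⟩
  induction hx using Submodule.span_induction with
  | mem x hx =>
    obtain ⟨i, hi, rfl⟩ := hx
    rw [Finset.mem_Icc] at hi
    rw [← Function.iterate_succ_apply' (⇑D)]
    exact Ideal.subset_span ⟨i + 1, Finset.mem_Icc.2 ⟨by omega, by omega⟩, rfl⟩
  | zero => simp
  | add x y _ _ hx hy => simpa only [map_add] using add_mem hx hy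
  | smul r x hx ih =>
    rw [smul_eq_mul, D.leibniz, smul_eq_mul, smul_eq_mul]
    exact add_mem (Ideal.mul_mem_left _ _ ih) (Ideal.mul_mem_right _ _ (mono hx))

/-- For `n ≥ 1`, the `n`-th derivative of a power of `a` lies in the ideal spanned by the first `n`
derivatives of `a`. -/
theorem Derivation.iterate_pow_mem_span (D : Derivation K R R) (a : R) (k : ℕ) {n : ℕ}
    (hn : 1 ≤ n) :
    (⇑D)^[n] (a ^ k) ∈ Ideal.span {x : R | ∃ i ∈ Finset.Icc 1 n, x = (⇑D)^[i] a} := by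
  induction n, hn using Nat.le_induction with
  | base =>
    rw [Function.iterate_one, D.leibniz_pow, ← Nat.cast_smul_eq_nsmul R, smul_eq_mul, smul_eq_mul]
    exact Ideal.mul_mem_left _ _ (Ideal.mul_mem_left _ _
      (Ideal.subset_span ⟨1, by simp, rfl⟩))
  | succ n _ ih =>
    rw [Function.iterate_succ_apply']
    exact D.map_mem_span_iterate_succ ih

end IteratedDerivation

theorem statement17 (K : Type*) [Field K] [CharZero K]
    (R : Type*) [CommRing R] [Algebra K R] (D : Derivation K R R)
    (k : ℕ) (hk : 0 < k) (a b : R) (hab : D a = a ^ k + b)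
    (n : ℕ) (hn : 1 ≤ n) :
    Ideal.span {x : R | ∃ i ∈ Finset.Icc 1 n, x = (⇑D)^[i] a} =
      Ideal.span ({D a} ∪ {x : R | ∃ i ∈ Finset.Icc 1 (n - 1), x = (⇑D)^[i] b}) := by
  have key (i : ℕ) : (⇑D)^[i + 1] a = (⇑D)^[i] (a ^ k) + (⇑D)^[i] b := by
    rw [Function.iterate_succ_apply, hab, iterate_map_add]
  apply le_antisymm
  · suffices h : ∀ m ≤ n, Ideal.span {x : R | ∃ i ∈ Finset.Icc 1 m, x = (⇑D)^[i] a} ≤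
        Ideal.span ({D a} ∪ {x : R | ∃ i ∈ Finset.Icc 1 (n - 1), x = (⇑D)^[i] b}) from h n le_rfl
    intro m
    induction m with
    | zero => simp
    | succ m ih =>
      intro hm
      refine Ideal.span_le.2 ?_
      rintro _ ⟨i, hi, rfl⟩
      rw [Finset.mem_Icc] at hi
      rcases hi.2.lt_or_eq with hlt | rfl
      · exact ih (by omega) (Ideal.subset_span ⟨i, Finset.mem_Icc.2 ⟨hi.1, by omega⟩, rfl⟩)
      · rcases Nat.eq_zero_or_pos m with rfl | hpos
        · exact Ideal.subset_span (Or.inl rfl)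
        · rw [key, SetLike.mem_coe]
          exact add_mem (ih (by omega) (D.iterate_pow_mem_span a k hpos))
            (Ideal.subset_span (Or.inr ⟨m, Finset.mem_Icc.2 ⟨hpos, by omega⟩, rfl⟩))
  · refine Ideal.span_le.2 ?_
    rintro _ (rfl | ⟨i, hi, rfl⟩)
    · exact Ideal.subset_span ⟨1, Finset.mem_Icc.2 ⟨le_rfl, hn⟩, rfl⟩
    · rw [Finset.mem_Icc] at hi
      rw [← add_sub_cancel_left ((⇑D)^[i] (a ^ k)) ((⇑D)^[i] b), ← key, SetLike.mem_coe]
      refine sub_mem (Ideal.subset_span ⟨i + 1, Finset.mem_Icc.2 ⟨by omega, by omega⟩, rfl⟩)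
        (Ideal.span_mono ?_ (D.iterate_pow_mem_span a k hi.1))
      rintro _ ⟨j, hj, rfl⟩
      exact ⟨j, Finset.Icc_subset_Icc_right (by omega) hj, rfl⟩
end
end
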